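/- Every Nash equilibrium network of the min-flowNCG has edge connectivity at least k+1. -/

import Mathlib

open Finset

noncomputable section

/-- Total capacity crossing the cut `(A, Aᶜ)`: each unordered crossing pair
is counted once (for symmetric capacities). -/
def cutCap {V : Type*} [Fintype V] [DecidableEq V] (c : V → V → ℕ) (A : Finset V) : ℕ :=
  ∑ u ∈ A, ∑ v ∈ Aᶜ, c u v

/-- Local edge connectivity between `v` and `w`: the minimum capacity of a cut
separating `v` from `w`. -/
def localConn {V : Type*} [Fintype V] [DecidableEq V] (c : V → V → ℕ) (v w : V) : ℕ :=
  sInf {m | ∃ A : Finset V, v ∈ A ∧ w ∉ A ∧ cutCap c A = m}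

/-- Edge connectivity of the capacitated graph: the minimum capacity of a
nontrivial cut. -/
def edgeConn {V : Type*} [Fintype V] [DecidableEq V] (c : V → V → ℕ) : ℕ :=
  sInf {m | ∃ A : Finset V, A.Nonempty ∧ A ≠ Finset.univ ∧ cutCap c A = m}

/-- Weighted degree of a vertex: sum of capacities of incident edges. -/
def wdeg {V : Type*} [Fintype V] [DecidableEq V] (c : V → V → ℕ) (v : V) : ℕ :=
  ∑ w, c v w

/-- The undirected capacity induced by the bought (directed) capacities `b`. -/
def cap {V : Type*} (b : V → V → ℕ) : V → V → ℕ := fun u v => b u v + b v u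

/-- A strategy profile is feasible for budget `k` if nobody buys a self-loop
and each agent's total bought capacity is at most `k`. -/
def Feasible {V : Type*} [Fintype V] (k : ℕ) (b : V → V → ℕ) : Prop :=
  ∀ v, b v v = 0 ∧ ∑ w, b v w ≤ k

/-- Utility of agent `v` in the min-flowNCG: the lexicographic pair of the
edge connectivity of the network and the number of well-connected nodes. -/
def minUtil {V : Type*} [Fintype V] [DecidableEq V] (b : V → V → ℕ) (v : V) : ℕ × ℕ :=
  (edgeConn (cap b),
    Set.ncard {w | w ≠ v ∧ edgeConn (cap b) < localConn (cap b) v w})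

/-- Nash equilibrium of the min-flowNCG: the profile is feasible and no agent
can strictly lexicographically improve its utility by a unilateral deviation. -/
def MinNE {V : Type*} [Fintype V] [DecidableEq V] (k : ℕ) (b : V → V → ℕ) : Prop :=
  Feasible k b ∧ ∀ (v : V) (s : V → ℕ), s v = 0 → (∑ w, s w) ≤ k →
    ¬ Prod.Lex (· < ·) (· < ·) (minUtil b v) (minUtil (Function.update b v s) v)

/-- Utility of agent `v` in the avg-flowNCG: the average local edge
connectivity (max-flow value) from `v` to every other node. -/
def avgUtil {V : Type*} [Fintype V] [DecidableEq V] (b : V → V → ℕ) (v : V) : ℚ :=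
  (∑ w ∈ Finset.univ.erase v, (localConn (cap b) v w : ℚ)) / ((Fintype.card V : ℚ) - 1)

/-- Nash equilibrium of the avg-flowNCG: the profile is feasible and no agent
can strictly increase its utility by a unilateral deviation. -/
def AvgNE {V : Type*} [Fintype V] [DecidableEq V] (k : ℕ) (b : V → V → ℕ) : Prop :=
  Feasible k b ∧ ∀ (v : V) (s : V → ℕ), s v = 0 → (∑ w, s w) ≤ k →
    avgUtil (Function.update b v s) v ≤ avgUtil b v

/-- The total capacity bought by the members of `S` towards vertices outside `S`. -/
def outCap {V : Type*} [Fintype V] [DecidableEq V] (b : V → V → ℕ) (S : Finset V) : ℕ :=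
  ∑ u ∈ S, ∑ w ∈ Sᶜ, b u w

theorem cap_comm {V : Type*} (b : V → V → ℕ) (u w : V) : cap b u w = cap b w u := Nat.add_comm _ _

section Cuts

variable {V : Type*} [Fintype V] [DecidableEq V]

theorem cutCap_compl {c : V → V → ℕ} (hc : ∀ u w, c u w = c w u) (A : Finset V) :
    cutCap c Aᶜ = cutCap c A := by
  unfold cutCap
  rw [compl_compl, Finset.sum_comm]
  exact Finset.sum_congr rfl fun u _ => Finset.sum_congr rfl fun w _ => hc _ _

theorem edgeConn_le_cutCap (c : V → V → ℕ) {A : Finset V} {u w : V} (hu : u ∈ A) (hw : w ∉ A) :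
    edgeConn c ≤ cutCap c A :=
  Nat.sInf_le ⟨A, ⟨u, hu⟩, fun h => hw (h ▸ Finset.mem_univ w), rfl⟩

theorem localConn_le_cutCap (c : V → V → ℕ) {A : Finset V} {u w : V} (hu : u ∈ A) (hw : w ∉ A) :
    localConn c u w ≤ cutCap c A :=
  Nat.sInf_le ⟨A, hu, hw, rfl⟩

theorem exists_cutCap_eq_edgeConn [Nontrivial V] (c : V → V → ℕ) :
    ∃ A : Finset V, A.Nonempty ∧ A ≠ Finset.univ ∧ cutCap c A = edgeConn c := by
  obtain ⟨u, w, huw⟩ := exists_pair_ne V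
  exact Nat.sInf_mem (s := {m | ∃ A : Finset V, A.Nonempty ∧ A ≠ Finset.univ ∧ cutCap c A = m})
    ⟨_, {u}, Finset.singleton_nonempty u, fun h => huw (by
      have := Finset.mem_univ w
      rw [← h, Finset.mem_singleton] at this
      exact this.symm), rfl⟩

theorem exists_cutCap_eq_localConn (c : V → V → ℕ) {u w : V} (huw : u ≠ w) :
    ∃ A : Finset V, u ∈ A ∧ w ∉ A ∧ cutCap c A = localConn c u w :=
  Nat.sInf_mem (s := {m | ∃ A : Finset V, u ∈ A ∧ w ∉ A ∧ cutCap c A = m})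
    ⟨_, {u}, Finset.mem_singleton_self u, by simpa using huw.symm, rfl⟩

/-- For a symmetric capacity, some minimum cut has a prescribed vertex on its near side. -/
theorem exists_min_cut_mem [Nontrivial V] {c : V → V → ℕ} (hc : ∀ u w, c u w = c w u) (v : V) :
    ∃ A : Finset V, v ∈ A ∧ (∃ y, y ∉ A) ∧ cutCap c A = edgeConn c := by
  obtain ⟨A, ⟨a, ha⟩, hA, h⟩ := exists_cutCap_eq_edgeConn c
  by_cases hv : v ∈ A
  · refine ⟨A, hv, ?_, h⟩
    by_contra! hall
    exact hA (Finset.eq_univ_iff_forall.2 hall)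
  · exact ⟨Aᶜ, Finset.mem_compl.2 hv, ⟨a, by simpa using ha⟩, (cutCap_compl hc A).trans h⟩

/-- The effect on a cut of replacing the strategy of one agent. -/
theorem cutCap_update_add (b : V → V → ℕ) (s : V → ℕ) {v : V} {A : Finset V} (hv : v ∈ A) :
    cutCap (cap (Function.update b v s)) A + ∑ w ∈ Aᶜ, b v w =
      cutCap (cap b) A + ∑ w ∈ Aᶜ, s w := by
  unfold cutCap cap
  rw [← Finset.add_sum_erase A _ hv, ← Finset.add_sum_erase A _ hv]
  have hrest : ∑ u ∈ A.erase v, ∑ w ∈ Aᶜ,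
        (Function.update b v s u w + Function.update b v s w u) =
      ∑ u ∈ A.erase v, ∑ w ∈ Aᶜ, (b u w + b w u) := by
    refine Finset.sum_congr rfl fun u hu => Finset.sum_congr rfl fun w hw => ?_
    have hwv : w ≠ v := by
      rintro rfl
      exact Finset.mem_compl.1 hw hv
    rw [Function.update_of_ne (Finset.ne_of_mem_erase hu), Function.update_of_ne hwv]
  have hrow : ∑ w ∈ Aᶜ, (Function.update b v s v w + Function.update b v s w v) =
      ∑ w ∈ Aᶜ, (s w + b w v) := by
    refine Finset.sum_congr rfl fun w hw => ?_
    have hwv : w ≠ v := by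
      rintro rfl
      exact Finset.mem_compl.1 hw hv
    rw [Function.update_self, Function.update_of_ne hwv]
  rw [hrest, hrow, Finset.sum_add_distrib, Finset.sum_add_distrib]
  omega

theorem minUtil_lex_of_cutCap [Nontrivial V] (b b' : V → V → ℕ) {v y : V} (hvy : v ≠ y)
    (hy : localConn (cap b) v y ≤ edgeConn (cap b))
    (hmono : ∀ A : Finset V, v ∈ A → (∃ w, w ∉ A) →
      min (cutCap (cap b) A) (edgeConn (cap b) + 1) ≤ cutCap (cap b') A)
    (hsep : ∀ A : Finset V, v ∈ A → y ∉ A → edgeConn (cap b) + 1 ≤ cutCap (cap b') A) :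
    Prod.Lex (· < ·) (· < ·) (minUtil b v) (minUtil b' v) := by
  have hle : edgeConn (cap b) ≤ edgeConn (cap b') := by
    obtain ⟨A, hvA, ⟨w, hw⟩, h⟩ := exists_min_cut_mem (cap_comm b') v
    have h1 := hmono A hvA ⟨w, hw⟩
    have h2 := edgeConn_le_cutCap (cap b) hvA hw
    omega
  rcases hle.lt_or_eq with hlt | heq
  · exact Prod.Lex.left _ _ hlt
  · unfold minUtil
    rw [← heq]
    refine Prod.Lex.right _ (Set.ncard_lt_ncard ?_ (Set.toFinite _))
    refine (Set.ssubset_iff_of_subset ?_).2 ⟨y, ⟨hvy.symm, ?_⟩, fun h => ?_⟩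
    · rintro w ⟨hwv, hw⟩
      refine ⟨hwv, ?_⟩
      obtain ⟨A, hvA, hwA, h⟩ := exists_cutCap_eq_localConn (cap b') hwv.symm
      have h1 := hmono A hvA ⟨w, hwA⟩
      have h2 := localConn_le_cutCap (cap b) hvA hwA
      omega
    · obtain ⟨A, hvA, hyA, h⟩ := exists_cutCap_eq_localConn (cap b') hvy
      have := hsep A hvA hyA
      omega
    · exact absurd h.2 (by omega)

theorem MinNE.sum_eq [Nontrivial V] {k : ℕ} {b : V → V → ℕ} (hne : MinNE k b) (v : V) :
    ∑ w, b v w = k := by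
  refine le_antisymm (hne.1 v).2 ?_
  by_contra! hlt
  obtain ⟨B, hvB, ⟨y, hyB⟩, hB⟩ := exists_min_cut_mem (cap_comm b) v
  have hvy : v ≠ y := by
    rintro rfl
    exact hyB hvB
  set s : V → ℕ := fun w => b v w + if w = y then 1 else 0 with hs
  have hcut : ∀ A : Finset V, v ∈ A → cutCap (cap (Function.update b v s)) A =
      cutCap (cap b) A + if y ∈ A then 0 else 1 := by
    intro A hvA
    have h := cutCap_update_add b s hvA
    have h2 : ∑ w ∈ Aᶜ, s w = ∑ w ∈ Aᶜ, b v w + if y ∈ A then 0 else 1 := by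
      simp only [hs, Finset.sum_add_distrib, Finset.sum_ite_eq', Finset.mem_compl]
      split_ifs <;> simp_all
    omega
  refine hne.2 v s ?_ ?_ (minUtil_lex_of_cutCap b _ hvy
    ((localConn_le_cutCap _ hvB hyB).trans hB.le) (fun A hvA _ => ?_) fun A hvA hyA => ?_)
  · simp [hs, (hne.1 v).1, hvy]
  · simp only [hs, Finset.sum_add_distrib, Finset.sum_ite_eq', Finset.mem_univ, if_true]
    omega
  · rw [hcut A hvA]
    omega
  · rw [hcut A hvA, if_neg hyA]
    have := edgeConn_le_cutCap (cap b) hvA hyA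
    omega

/-- In an equilibrium no agent `v` can move one unit of capacity from `x` to some `y` beyond a
minimum cut when all cuts between `v` and `x` are large enough. -/
theorem MinNE.exists_cutCap_le [Nontrivial V] {k : ℕ} {b : V → V → ℕ} (hne : MinNE k b)
    {v x y : V} (hx : 0 < b v x) {B : Finset V} (hvB : v ∈ B) (hyB : y ∉ B)
    (hB : cutCap (cap b) B = edgeConn (cap b))
    (hsep : ∀ A : Finset V, v ∈ A → x ∉ A → edgeConn (cap b) + 1 ≤ cutCap (cap b) A) :
    ∃ A : Finset V, v ∈ A ∧ x ∉ A ∧ y ∈ A ∧ cutCap (cap b) A ≤ edgeConn (cap b) + 1 := by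
  by_contra! hbig
  have hvy : v ≠ y := by
    rintro rfl
    exact hyB hvB
  have hvx : x ≠ v := by
    rintro rfl
    exact hx.ne' (hne.1 x).1
  have hvv := (hne.1 v).1
  set s : V → ℕ := fun w => (b v w - if w = x then 1 else 0) + if w = y then 1 else 0 with hs
  have hsum : ∀ S : Finset V, ∑ w ∈ S, s w + (if x ∈ S then 1 else 0) =
      ∑ w ∈ S, b v w + if y ∈ S then 1 else 0 := by
    intro S
    rw [← Finset.sum_ite_eq' S x fun _ => 1, ← Finset.sum_ite_eq' S y fun _ => 1,
      ← Finset.sum_add_distrib, ← Finset.sum_add_distrib]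
    refine Finset.sum_congr rfl fun w _ => ?_
    by_cases hwx : w = x
    · subst hwx
      simp only [hs, if_true]
      omega
    · simp [hs, hwx]
  have hcut : ∀ A : Finset V, v ∈ A → cutCap (cap (Function.update b v s)) A +
      (if x ∈ A then 0 else 1) = cutCap (cap b) A + if y ∈ A then 0 else 1 := by
    intro A hvA
    have h := cutCap_update_add b s hvA
    have h2 := hsum Aᶜ
    simp only [Finset.mem_compl, ite_not] at h2
    omega
  refine hne.2 v s ?_ ?_ (minUtil_lex_of_cutCap b _ hvy
    ((localConn_le_cutCap _ hvB hyB).trans hB.le) (fun A hvA _ => ?_) fun A hvA hyA => ?_)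
  · simp [hs, hvv, hvy]
  · have h := hsum Finset.univ
    simp only [Finset.mem_univ, if_true] at h
    have := (hne.1 v).2
    omega
  · have h := hcut A hvA
    by_cases hxA : x ∈ A
    · rw [if_pos hxA] at h
      omega
    · have h1 := hsep A hvA hxA
      by_cases hyA : y ∈ A
      · have h2 := hbig A hvA hxA hyA
        simp only [hxA, hyA, if_true, if_false] at h
        omega
      · simp only [hxA, hyA, if_false] at h
        omega
  · have h := hcut A hvA
    rw [if_neg hyA] at h
    have h0 := edgeConn_le_cutCap (cap b) hvA hyA
    by_cases hxA : x ∈ A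
    · rw [if_pos hxA] at h
      omega
    · have h1 := hsep A hvA hxA
      rw [if_neg hxA] at h
      omega

/-- Splitting a set into two parts creates as much additional outgoing capacity as there is
capacity between the parts. -/
theorem outCap_inter_add_outCap_sdiff (b : V → V → ℕ) (Z A : Finset V) :
    outCap b (Z ∩ A) + outCap b (Z \ A) =
      outCap b Z + ∑ u ∈ Z ∩ A, ∑ w ∈ Z \ A, cap b u w := by
  have h1 : (Z ∩ A)ᶜ = (Z \ A) ∪ Zᶜ := by
    ext u
    simp only [Finset.mem_compl, Finset.mem_inter, Finset.mem_union, Finset.mem_sdiff]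
    tauto
  have h2 : (Z \ A)ᶜ = (Z ∩ A) ∪ Zᶜ := by
    ext u
    simp only [Finset.mem_compl, Finset.mem_inter, Finset.mem_union, Finset.mem_sdiff]
    tauto
  have d1 : Disjoint (Z \ A) Zᶜ :=
    Finset.disjoint_left.2 fun u hu hu' => Finset.mem_compl.1 hu' (Finset.mem_sdiff.1 hu).1
  have d2 : Disjoint (Z ∩ A) Zᶜ :=
    Finset.disjoint_left.2 fun u hu hu' => Finset.mem_compl.1 hu' (Finset.mem_inter.1 hu).1
  have h3 : outCap b Z =
      ∑ u ∈ Z ∩ A, ∑ w ∈ Zᶜ, b u w + ∑ u ∈ Z \ A, ∑ w ∈ Zᶜ, b u w :=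
    (Finset.sum_inter_add_sum_sdiff Z A _).symm
  rw [h3]
  unfold outCap cap
  rw [h1, h2]
  simp only [Finset.sum_union d1, Finset.sum_union d2, Finset.sum_add_distrib]
  rw [Finset.sum_comm (s := Z \ A) (t := Z ∩ A)]
  omega

/-- `Z` is inclusion-minimal among the nonempty sets buying less than `k` units towards the
outside. -/
def IsMinimalHeavy (k : ℕ) (b : V → V → ℕ) (Z : Finset V) : Prop :=
  Minimal (fun S : Finset V => S.Nonempty ∧ outCap b S < k) Z

theorem exists_isMinimalHeavy [Nonempty V] {k : ℕ} (hk : 1 ≤ k) (b : V → V → ℕ) :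
    ∃ Z, IsMinimalHeavy k b Z :=
  exists_minimal_of_wellFoundedLT _ ⟨Finset.univ, Finset.univ_nonempty, by simpa [outCap]⟩

theorem IsMinimalHeavy.le_outCap {k : ℕ} {b : V → V → ℕ} {Z W : Finset V}
    (hZ : IsMinimalHeavy k b Z) (hW : W.Nonempty) (hWZ : W ⊂ Z) : k ≤ outCap b W := by
  by_contra! h
  exact hZ.not_prop_of_lt hWZ ⟨hW, h⟩

theorem IsMinimalHeavy.add_one_le_sum {k : ℕ} {b : V → V → ℕ} {Z A : Finset V}
    (hZ : IsMinimalHeavy k b Z) {p q : V} (hp : p ∈ Z) (hpA : p ∈ A) (hq : q ∈ Z) (hqA : q ∉ A) :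
    k + 1 ≤ ∑ u ∈ Z ∩ A, ∑ w ∈ Z \ A, cap b u w := by
  have h1 := hZ.le_outCap (W := Z ∩ A) ⟨p, Finset.mem_inter.2 ⟨hp, hpA⟩⟩
    (Finset.ssubset_iff_subset_ne.2 ⟨Finset.inter_subset_left, fun h =>
      hqA (Finset.mem_inter.1 (h.symm ▸ hq)).2⟩)
  have h2 := hZ.le_outCap (W := Z \ A) ⟨q, Finset.mem_sdiff.2 ⟨hq, hqA⟩⟩
    (Finset.ssubset_iff_subset_ne.2 ⟨Finset.sdiff_subset, fun h =>
      (Finset.mem_sdiff.1 (h.symm ▸ hp)).2 hpA⟩)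
  have h3 := hZ.prop.2
  have h4 := outCap_inter_add_outCap_sdiff b Z A
  omega

/-- Cuts splitting a minimal heavy set have capacity at least `k + 1`. -/
theorem IsMinimalHeavy.add_one_le_cutCap {k : ℕ} {b : V → V → ℕ} {Z A : Finset V}
    (hZ : IsMinimalHeavy k b Z) {p q : V} (hp : p ∈ Z) (hpA : p ∈ A) (hq : q ∈ Z) (hqA : q ∉ A) :
    k + 1 ≤ cutCap (cap b) A := by
  refine (hZ.add_one_le_sum hp hpA hq hqA).trans ?_
  unfold cutCap
  rw [← Finset.sum_product', ← Finset.sum_product']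
  refine Finset.sum_le_sum_of_subset (Finset.product_subset_product Finset.inter_subset_right ?_)
  exact fun w hw => Finset.mem_compl.2 (Finset.mem_sdiff.1 hw).2

/-- A cut of capacity `k + 1` splitting a minimal heavy set has all its capacity inside that
set. -/
theorem IsMinimalHeavy.cap_eq_zero {k : ℕ} {b : V → V → ℕ} {Z A : Finset V}
    (hZ : IsMinimalHeavy k b Z) {p q : V} (hp : p ∈ Z) (hpA : p ∈ A) (hq : q ∈ Z) (hqA : q ∉ A)
    (hA : cutCap (cap b) A ≤ k + 1) {u w : V} (hu : u ∈ A) (hw : w ∉ A) (huw : ¬(u ∈ Z ∧ w ∈ Z)) :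
    cap b u w = 0 := by
  have h1 := hZ.add_one_le_sum hp hpA hq hqA
  have hnot : (u, w) ∉ (Z ∩ A) ×ˢ (Z \ A) := by
    simp only [Finset.mem_product, Finset.mem_inter, Finset.mem_sdiff]
    tauto
  have hsub : insert (u, w) ((Z ∩ A) ×ˢ (Z \ A)) ⊆ A ×ˢ Aᶜ := by
    refine Finset.insert_subset (by simp [hu, hw])
      (Finset.product_subset_product Finset.inter_subset_right ?_)
    exact fun w hw => Finset.mem_compl.2 (Finset.mem_sdiff.1 hw).2
  have h2 := Finset.sum_le_sum_of_subset (f := fun e : V × V => cap b e.1 e.2) hsub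
  rw [Finset.sum_insert hnot, Finset.sum_product, Finset.sum_product] at h2
  unfold cutCap at hA
  simp only at h2
  omega

/-- Every member of a minimal heavy set receives an edge bought inside the set. -/
theorem IsMinimalHeavy.exists_pos {k : ℕ} {b : V → V → ℕ} {Z : Finset V}
    (hZ : IsMinimalHeavy k b Z) (hb : ∀ v, b v v = 0) (hsum : ∀ v, ∑ w, b v w = k) {z : V}
    (hz : z ∈ Z) : ∃ v ∈ Z, 0 < b v z := by
  by_contra! h
  have hcompl : (Z.erase z)ᶜ = insert z Zᶜ := Finset.compl_erase
  have hle : outCap b (Z.erase z) ≤ outCap b Z := by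
    unfold outCap
    rw [hcompl]
    refine (Finset.sum_le_sum fun u hu => ?_).trans
      (Finset.sum_le_sum_of_subset (Finset.erase_subset z Z))
    rw [Finset.sum_insert (by simpa using hz), Nat.le_zero.1 (h u (Finset.mem_of_mem_erase hu)),
      zero_add]
  have hlt := hZ.prop.2
  rcases (Z.erase z).eq_empty_or_nonempty with he | hne
  · have hZz : Z = {z} := by
      rw [← Finset.insert_erase hz, he]
      rfl
    have h1 := Finset.sum_compl_add_sum ({z} : Finset V) (b z)
    rw [Finset.sum_singleton, hb, hsum] at h1
    rw [hZz, outCap, Finset.sum_singleton] at hlt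
    omega
  · have := hZ.le_outCap hne (Finset.erase_ssubset hz)
    omega

end Cuts

/-- Every Nash equilibrium network of the min-flowNCG is `(k+1)`-edge-connected:
its edge connectivity is at least `k + 1`. -/
theorem minNE_edgeConn_ge {V : Type*} [Fintype V] [DecidableEq V]
    (k : ℕ) (b : V → V → ℕ)
    (hk1 : 1 ≤ k) (hk : k < Fintype.card V)
    (hne : MinNE k b) :
    k + 1 ≤ edgeConn (cap b) := by
  have : Nontrivial V := Fintype.one_lt_card_iff_nontrivial.1 (by omega)
  by_contra! hlt
  obtain ⟨Z, hZ⟩ := exists_isMinimalHeavy hk1 b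
  obtain ⟨z₀, hz₀⟩ := hZ.prop.1
  obtain ⟨B, hzB, ⟨y, hyB⟩, hB⟩ := exists_min_cut_mem (cap_comm b) z₀
  have hZB : Z ⊆ B := by
    intro z hz
    by_contra hzB'
    have := hZ.add_one_le_cutCap hz₀ hzB hz hzB'
    omega
  have hbad : ∀ z ∈ Z, ∃ A : Finset V, z ∉ A ∧ y ∈ A ∧ cutCap (cap b) A ≤ edgeConn (cap b) + 1 ∧
      ∃ v ∈ Z, v ∈ A := by
    intro z hz
    obtain ⟨v, hv, hvz⟩ := hZ.exists_pos (fun v => (hne.1 v).1) hne.sum_eq hz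
    obtain ⟨A, hvA, hzA, hyA, hA⟩ := hne.exists_cutCap_le hvz (hZB hv) hyB hB fun A hvA hzA =>
      (by omega : edgeConn (cap b) + 1 ≤ k + 1).trans (hZ.add_one_le_cutCap hv hvA hz hzA)
    exact ⟨A, hzA, hyA, hA, v, hv, hvA⟩
  choose! A hzA hyA hA v hv hvA using hbad
  have hconn : 1 ≤ edgeConn (cap b) := by
    have := hZ.add_one_le_cutCap (hv z₀ hz₀) (hvA z₀ hz₀) hz₀ (hzA z₀ hz₀)
    have := hA z₀ hz₀
    omega
  -- The vertices lying outside `Z` and on the side of `y` in all these cuts are isolated from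
  -- the rest of the network.
  set K : Finset V := Finset.univ.filter fun w => w ∉ Z ∧ ∀ z ∈ Z, w ∈ A z with hK
  have hyK : y ∈ K := by
    rw [hK, Finset.mem_filter]
    exact ⟨Finset.mem_univ y, fun h => hyB (hZB h), hyA⟩
  have hz₀K : z₀ ∉ K := fun h => (Finset.mem_filter.1 h).2.1 hz₀
  have hzero : cutCap (cap b) K = 0 := by
    refine Finset.sum_eq_zero fun u hu => Finset.sum_eq_zero fun w hw => ?_
    obtain ⟨-, huZ, huA⟩ := Finset.mem_filter.1 hu
    obtain ⟨z, hz, hwA⟩ : ∃ z ∈ Z, w ∉ A z := by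
      by_cases hwZ : w ∈ Z
      · exact ⟨w, hwZ, hzA w hwZ⟩
      · by_contra! hall
        exact Finset.mem_compl.1 hw (Finset.mem_filter.2 ⟨Finset.mem_univ w, hwZ, hall⟩)
    refine hZ.cap_eq_zero (hv z hz) (hvA z hz) hz (hzA z hz) ?_ (huA z hz) hwA fun h => huZ h.1
    have := hA z hz
    omega
  have := edgeConn_le_cutCap (cap b) hyK hz₀K
  omega
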